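/- Let f : [−1,1] → ℝ be (k+1)-times continuously differentiable for some k ≥ 1, and let f_n denote the truncated Chebyshev expansion of f of degree n (with the constant term halved). Then for all n > k+1, ‖f − f_n‖_{L^∞([−1,1])} ≤ C̃_k · ‖f^{(k+1)}‖_{L^∞([−1,1])} · n^{−k+1}, where C̃_k = 4^{k+1} · 6(3e)^k / (1+k) depends only on k. Consequently, for ε > 0 and n_k = max{k+2, ⌈(2 C̃_k ‖f^{(k+1)}‖_∞ / ε)^{1/(k−1)}⌉} with k ≥ 2, one has ‖f − f_{n_k}‖_{L^∞([−1,1])} ≤ ε/2. -/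

import Mathlib

open Real in
noncomputable def cc (f : ℝ → ℝ) (j : ℕ) : ℝ := ∫ θ in (0:ℝ)..π, f (cos θ) * cos (j * θ)

open Real in
theorem cc_rec (f : ℝ → ℝ) (hf : ContDiff ℝ 1 f) (j : ℕ) :
    cc f (j+1) * ((j:ℝ)+1) = (cc (deriv f) j - cc (deriv f) (j+2)) / 2 := by
  have hj : ((j:ℝ)+1) ≠ 0 := by positivity
  have hc : Continuous (deriv f) := hf.continuous_deriv le_rfl
  have hd : Differentiable ℝ f := hf.differentiable one_ne_zero
  have h1 := intervalIntegral.integral_mul_deriv_eq_deriv_mul (a := 0) (b := π)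
    (u := fun θ => f (cos θ)) (v := fun θ => sin (((j:ℝ)+1) * θ))
    (u' := fun θ => deriv f (cos θ) * (- sin θ))
    (v' := fun θ => cos (((j:ℝ)+1) * θ) * ((j:ℝ)+1))
    (fun x _ => by
      exact (hd (cos x)).hasDerivAt.comp x (hasDerivAt_cos x))
    (fun x _ => by
      have := ((hasDerivAt_id x).const_mul ((j:ℝ)+1)).sin
      simpa using this)
    (by apply Continuous.intervalIntegrable; fun_prop)
    (by apply Continuous.intervalIntegrable; fun_prop)
  have h2 : sin (((j:ℝ)+1) * π) = 0 := by
    have := sin_nat_mul_pi (j+1)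
    push_cast at this; exact this
  simp only [h2, mul_zero, sin_zero, sub_zero, zero_sub] at h1
  unfold cc
  rw [← intervalIntegral.integral_mul_const, ← intervalIntegral.integral_sub, 
    ← intervalIntegral.integral_div]
  · push_cast
    simp only [mul_assoc]
    rw [h1, ← intervalIntegral.integral_neg]
    apply intervalIntegral.integral_congr
    intro θ _
    have e1 : cos ((j:ℝ) * θ) = cos (((j:ℝ)+1) * θ - θ) := by ring_nf
    have e2 : cos (((j:ℝ)+2) * θ) = cos (((j:ℝ)+1) * θ + θ) := by ring_nf
    simp only [e1, e2, cos_sub, cos_add]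
    ring
  · apply Continuous.intervalIntegrable; fun_prop
  · apply Continuous.intervalIntegrable; fun_prop

open Real in
theorem cc_bound (M : ℝ) (m : ℕ) : ∀ (f : ℝ → ℝ), ContDiff ℝ m f →
    (∀ x ∈ Set.Icc (-1:ℝ) 1, |iteratedDeriv m f x| ≤ M) → ∀ j, m ≤ j →
    |cc f j| * (j.descFactorial m : ℝ) ≤ π * M := by
  induction m with
  | zero =>
    intro f hf hM j _
    simp only [iteratedDeriv_zero] at hM
    have := intervalIntegral.norm_integral_le_of_norm_le_const (a := 0) (b := π) (C := M)
      (f := fun θ => f (cos θ) * cos (j * θ)) (fun θ _ => by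
        rw [norm_mul]
        have h1 := hM (cos θ) ⟨neg_one_le_cos θ, cos_le_one θ⟩
        have h2 := abs_cos_le_one (j * θ)
        simp only [Real.norm_eq_abs]
        calc _ ≤ |f (cos θ)| * 1 := by gcongr
          _ ≤ M := by simpa using h1)
    simp only [sub_zero, abs_of_pos pi_pos, Real.norm_eq_abs] at this
    simp only [Nat.descFactorial_zero, Nat.cast_one, mul_one, cc]
    linarith
  | succ m ih =>
    intro f hf hM j hj
    obtain ⟨i, rfl⟩ : ∃ i, j = i + 1 := ⟨j - 1, by omega⟩
    have hf' : ContDiff ℝ m (deriv f) := by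
      have : ContDiff ℝ ((m:WithTop ℕ∞)+1) f := by exact_mod_cast hf
      exact ((contDiff_succ_iff_deriv (n := (m:WithTop ℕ∞))).1 this).2.2
    rw [iteratedDeriv_succ'] at hM
    have h1 := ih (deriv f) hf' hM i (by omega)
    have h2 := ih (deriv f) hf' hM (i+2) (by omega)
    have hr := cc_rec f (hf.of_le (by exact_mod_cast Nat.le_add_left 1 m)) i
    have hD : ((i.descFactorial m : ℕ) : ℝ) ≤ ((i+2).descFactorial m : ℕ) := by
      exact_mod_cast Nat.descFactorial_le m (by omega)
    have h3 : |cc (deriv f) (i+2)| * (i.descFactorial m : ℝ) ≤ π * M :=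
      le_trans (by gcongr) h2
    rw [Nat.succ_descFactorial_succ]
    push_cast
    have : |cc f (i+1)| * ((i:ℝ)+1) ≤ (|cc (deriv f) i| + |cc (deriv f) (i+2)|)/2 := by
      have h0 : |cc f (i+1)| * ((i:ℝ)+1) = |cc f (i+1) * ((i:ℝ)+1)| := by
        rw [abs_mul, abs_of_pos (show (0:ℝ) < (i:ℝ)+1 by positivity)]
      rw [h0, hr, abs_div, abs_two]
      gcongr
      exact abs_sub _ _
    calc |cc f (i+1)| * (((i:ℝ)+1) * (i.descFactorial m : ℝ))
        = (|cc f (i+1)| * ((i:ℝ)+1)) * (i.descFactorial m : ℝ) := by ring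
      _ ≤ ((|cc (deriv f) i| + |cc (deriv f) (i+2)|)/2) * (i.descFactorial m : ℝ) := by gcongr
      _ ≤ π * M := by linarith

theorem tele (k n : ℕ) (hk : 1 ≤ k) (hn : k ≤ n) :
    1 / (((n+1).descFactorial (k+1) : ℕ) : ℝ) =
      1 / ((k:ℝ) * (n.descFactorial k : ℕ)) - 1 / ((k:ℝ) * ((n+1).descFactorial k : ℕ)) := by
  obtain ⟨l, rfl⟩ : ∃ l, k = l + 1 := ⟨k - 1, by omega⟩
  obtain ⟨d, rfl⟩ : ∃ d, n = l + 1 + d := ⟨n - (l+1), by omega⟩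
  have hp : ((l+1+d).descFactorial l : ℝ) ≠ 0 := by
    exact_mod_cast (Nat.descFactorial_pos.2 (by omega)).ne'
  rw [Nat.succ_descFactorial_succ, Nat.succ_descFactorial_succ, Nat.descFactorial_succ,
    show l + 1 + d - l = d + 1 by omega]
  push_cast
  field_simp
  ring

theorem tele_sum (k n : ℕ) (hk : 1 ≤ k) (hn : k ≤ n) (m : ℕ) :
    ∑ i ∈ Finset.range m, 1 / (((i+(n+1)).descFactorial (k+1) : ℕ) : ℝ)
      ≤ 1 / ((k:ℝ) * (n.descFactorial k : ℕ)) := by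
  have : ∑ i ∈ Finset.range m, 1 / (((i+(n+1)).descFactorial (k+1) : ℕ) : ℝ)
      = 1 / ((k:ℝ) * (n.descFactorial k : ℕ)) - 1 / ((k:ℝ) * ((n+m).descFactorial k : ℕ)) := by
    induction m with
    | zero => simp
    | succ m ih =>
      rw [Finset.sum_range_succ, ih, show m + (n+1) = (n+m)+1 by ring,
        tele k (n+m) hk (by omega), show n + (m+1) = n+m+1 by ring]
      ring
  rw [this]
  have : 0 ≤ 1 / ((k:ℝ) * ((n+m).descFactorial k : ℕ)) := by positivity
  linarith

theorem pow_le_desc (k n : ℕ) (hn : k ≤ n) :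
    (n:ℝ)^k ≤ Real.exp 1 ^ k * (n.descFactorial k : ℕ) := by
  have h1 : n^k * k.factorial ≤ n.descFactorial k * k^k := by
    rw [← Nat.descFactorial_self k, Nat.descFactorial_eq_prod_range,
      Nat.descFactorial_eq_prod_range]
    have : ∀ c : ℕ, c^k = ∏ i ∈ Finset.range k, c := by intro c; simp
    rw [this n, this k, ← Finset.prod_mul_distrib, ← Finset.prod_mul_distrib]
    apply Finset.prod_le_prod'
    intro i hi
    have := Finset.mem_range.1 hi
    obtain ⟨a, rfl⟩ : ∃ a, k = i + a := ⟨k - i, by omega⟩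
    obtain ⟨b, rfl⟩ : ∃ b, n = i + a + b := ⟨n - (i+a), by omega⟩
    rw [show i + a - i = a by omega, show i + a + b - i = a + b by omega]
    nlinarith [Nat.zero_le (i*b)]
  have h2 := Real.pow_div_factorial_le_exp (x := (k:ℝ)) (by positivity) k
  have hfp : (0:ℝ) < k.factorial := by exact_mod_cast k.factorial_pos
  rw [div_le_iff₀ hfp] at h2
  have h3 : Real.exp 1 ^ k = Real.exp k := by rw [← Real.exp_nat_mul]; simp
  have h1' : (n:ℝ)^k * k.factorial ≤ n.descFactorial k * (k:ℝ)^k := by exact_mod_cast h1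
  rw [h3]
  refine le_of_mul_le_mul_right ?_ hfp
  calc _ ≤ _ := h1'
    _ ≤ n.descFactorial k * (Real.exp k * k.factorial) := by gcongr
    _ = _ := by ring

open Real in
theorem four_sum (f : ℝ → ℝ) (hf : Continuous f) (hs : Summable (cc f)) (θ : ℝ) :
    HasSum (fun j : ℕ => (2/π) * cc f j * cos (j * θ)) (f (cos θ) + (1/2) * ((2/π) * cc f 0)) := by
  haveI : Fact (0 < 2 * π) := ⟨two_pi_pos⟩
  have hper : Function.Periodic (fun t : ℝ => ((f (cos t) : ℝ) : ℂ)) (2 * π) := by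
    intro t; simp
  let g : C(AddCircle (2*π), ℂ) := ⟨hper.lift, by
    apply continuous_coinduced_dom.mpr
    change Continuous (fun t : ℝ => ((f (cos t) : ℝ) : ℂ))
    fun_prop⟩
  have hg : ∀ t : ℝ, g (t : AddCircle (2*π)) = ((f (cos t) : ℝ) : ℂ) := fun t => rfl
  have hfo : ∀ (n : ℤ) (t : ℝ), fourier n (t : AddCircle (2*π)) = Complex.exp ((n * t : ℝ) * Complex.I) := by
    intro n t
    rw [fourier_coe_apply]
    congr 1
    push_cast
    have : (π:ℂ) ≠ 0 := by exact_mod_cast pi_ne_zero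
    field_simp
  have hcoef : ∀ n : ℤ, fourierCoeff g n = (((1/π) * cc f n.natAbs : ℝ) : ℂ) := by
    intro n
    rw [fourierCoeff_eq_intervalIntegral g n (-π), show -π + 2 * π = π by ring]
    have hcont : Continuous (fun x : ℝ => Complex.exp (((-n:ℤ) * x : ℝ) * Complex.I) * ((f (cos x) : ℝ) : ℂ)) := by
      fun_prop
    simp only [hfo, hg, smul_eq_mul]
    rw [← intervalIntegral.integral_add_adjacent_intervals (b := 0) (hcont.intervalIntegrable _ _)
      (hcont.intervalIntegrable _ _)]
    have hneg := intervalIntegral.integral_comp_neg (a := 0) (b := π) (fun x : ℝ => Complex.exp (((-n:ℤ) * x : ℝ) * Complex.I) * ((f (cos x) : ℝ) : ℂ))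
    rw [neg_zero] at hneg
    rw [← hneg, ← intervalIntegral.integral_add (Continuous.intervalIntegrable (by fun_prop) _ _) (hcont.intervalIntegrable _ _)]
    have : ∀ x : ℝ, Complex.exp (((-n:ℤ) * (-x) : ℝ) * Complex.I) * ((f (cos (-x)) : ℝ) : ℂ) + Complex.exp (((-n:ℤ) * x : ℝ) * Complex.I) * ((f (cos x) : ℝ) : ℂ) = ((2 * (f (cos x) * cos (n.natAbs * x)) : ℝ) : ℂ) := by
      intro x
      have hc : cos (n.natAbs * x) = cos (n * x) := by
        rcases Int.natAbs_eq n with h | h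
        · conv_rhs => rw [h]
          simp
        · conv_rhs => rw [h]
          simp
      rw [hc, cos_neg]
      push_cast
      rw [Complex.cos]
      ring_nf
    simp only [this]
    rw [intervalIntegral.integral_ofReal, intervalIntegral.integral_const_mul]
    unfold cc
    rw [Complex.real_smul, ← Complex.ofReal_mul]
    congr 1
    field_simp
  have hsum : Summable (fourierCoeff g) := by
    have h1 : Summable (fun n : ℕ => (((1/π) * cc f n : ℝ) : ℂ)) :=
      Complex.ofRealCLM.summable (hs.mul_left (1/π))
    refine Summable.of_nat_of_neg ?_ ?_
    · refine h1.congr fun n => ?_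
      rw [hcoef]; simp
    · refine h1.congr fun n => ?_
      rw [hcoef]; simp
  have H := (has_pointwise_sum_fourier_series_of_summable hsum (θ : AddCircle (2*π))).nat_add_neg
  simp only [hcoef, hfo, hg, smul_eq_mul] at H
  have H2 := Complex.reCLM.hasSum H
  convert H2 using 1
  · funext j
    simp only [Function.comp, Complex.reCLM_apply, Complex.add_re, Complex.re_ofReal_mul,
      Complex.exp_ofReal_mul_I_re]
    simp
    ring
  · simp
    ring

open Real in
theorem main_bound (f : ℝ → ℝ) (k n : ℕ) (hk : 1 ≤ k) (hn : k ≤ n) (hf : ContDiff ℝ (k+1) f)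
    (M : ℝ) (hM : ∀ x ∈ Set.Icc (-1:ℝ) 1, |iteratedDeriv (k+1) f x| ≤ M) (θ : ℝ) :
    |f (cos θ) + (1/2) * ((2/π) * cc f 0) - ∑ j ∈ Finset.range (n+1), (2/π) * cc f j * cos (j * θ)|
      ≤ 2 * M * (1 / ((k:ℝ) * (n.descFactorial k : ℕ))) := by
  have hM0 : 0 ≤ M := (abs_nonneg _).trans (hM 0 (by simp))
  have hb : ∀ i : ℕ, |cc f (i+(n+1))| ≤ π * M * (1 / (((i+(n+1)).descFactorial (k+1) : ℕ) : ℝ)) := by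
    intro i
    have := cc_bound M (k+1) f (by exact_mod_cast hf) hM (i+(n+1)) (by omega)
    have hp : (0:ℝ) < ((i+(n+1)).descFactorial (k+1) : ℕ) := by
      exact_mod_cast Nat.descFactorial_pos.2 (by omega)
    rw [mul_one_div, le_div_iff₀ hp]
    exact this
  have hs : Summable (cc f) := by
    rw [← summable_nat_add_iff (n+1)]
    apply Summable.of_abs
    apply summable_of_sum_range_le (c := π * M * (1 / ((k:ℝ) * (n.descFactorial k : ℕ)))) (fun _ => abs_nonneg _)
    intro m
    refine (Finset.sum_le_sum fun i _ => hb i).trans ?_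
    rw [← Finset.mul_sum]
    have := tele_sum k n hk hn m
    gcongr
  have H := four_sum f hf.continuous hs θ
  rw [← hasSum_nat_add_iff' (n+1)] at H
  refine le_of_tendsto H.tendsto_sum_nat.abs (Filter.Eventually.of_forall fun m => ?_)
  refine (Finset.abs_sum_le_sum_abs _ _).trans ?_
  calc _ ≤ ∑ i ∈ Finset.range m, 2 * M * (1 / (((i+(n+1)).descFactorial (k+1) : ℕ) : ℝ)) := by
        refine Finset.sum_le_sum fun i _ => ?_
        rw [abs_mul, abs_mul, abs_of_pos (show 0 < 2/π by positivity)]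
        calc _ ≤ 2/π * |cc f (i+(n+1))| * 1 := by
              gcongr; exact abs_cos_le_one _
          _ ≤ 2/π * (π * M * (1 / (((i+(n+1)).descFactorial (k+1) : ℕ) : ℝ))) * 1 := by
              gcongr; exact hb i
          _ = _ := by
              have := pi_ne_zero
              field_simp
    _ ≤ _ := by
        rw [← Finset.mul_sum]
        have := tele_sum k n hk hn m
        gcongr

theorem const_bound (k n : ℕ) (hk : 1 ≤ k) (hn : k < n) :
    2 * (1 / ((k:ℝ) * (n.descFactorial k : ℕ))) ≤
      4^(k+1) * 6 * (3 * Real.exp 1)^k / (1 + (k:ℝ)) * (n:ℝ) ^ ((1:ℤ) - (k:ℤ)) := by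
  have hn0 : (0:ℝ) < n := by exact_mod_cast (by omega : 0 < n)
  have hk1 : (1:ℝ) ≤ k := by exact_mod_cast hk
  have hn1 : (1:ℝ) ≤ n := by exact_mod_cast (by omega : 1 ≤ n)
  have hD : (0:ℝ) < (n.descFactorial k : ℕ) := by
    exact_mod_cast Nat.descFactorial_pos.2 (by omega)
  have h := pow_le_desc k n hn.le
  rw [zpow_sub₀ hn0.ne', zpow_one, zpow_natCast, mul_pow]
  set E := Real.exp 1 ^ k
  have hE : 0 < E := by positivity
  set D : ℝ := ((n.descFactorial k : ℕ) : ℝ)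
  have h4 : (1:ℝ) ≤ 4^(k+1) * 3^k := by
    have := one_le_pow₀ (show (1:ℝ) ≤ 4 by norm_num) (n := k+1)
    have := one_le_pow₀ (show (1:ℝ) ≤ 3 by norm_num) (n := k)
    nlinarith
  have e1 : 2 * (1 / ((k:ℝ) * D)) ≤ 2 * (E / (k * (n:ℝ)^k)) := by
    gcongr 2 * ?_
    rw [div_le_div_iff₀ (by positivity) (by positivity)]
    nlinarith
  refine e1.trans ?_
  rw [mul_div_assoc', div_mul_div_comm, div_le_div_iff₀ (by positivity) (by positivity)]
  have h5 : 2 * (1 + (k:ℝ)) ≤ (4^(k+1) * 3^k) * 6 * n * k := by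
    have : 1 ≤ (4^(k+1) * 3^k) * (n:ℝ) := by nlinarith
    nlinarith
  have h6 : 0 < E * (n:ℝ)^k := by positivity
  nlinarith [mul_le_mul_of_nonneg_left h5 h6.le]

theorem stmt_11 (f : ℝ → ℝ) (k : ℕ) (hk : 1 ≤ k) (hf : ContDiff ℝ (k+1) f)
    (a : ℕ → ℝ)
    (ha : ∀ j : ℕ, a j =
      (2 / Real.pi) * ∫ x in (-1:ℝ)..1,
        Real.cos (j * Real.arccos x) * f x / Real.sqrt (1 - x^2))
    (fn : ℕ → ℝ → ℝ)
    (hfn : ∀ n : ℕ, ∀ x : ℝ, fn n x =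
      (1/2) * a 0 + ∑ j ∈ Finset.Icc 1 n, a j * Real.cos (j * Real.arccos x))
    (M : ℝ) (hM : M = sSup ((fun x => |iteratedDeriv (k+1) f x|) '' Set.Icc (-1:ℝ) 1))
    (Ck : ℝ) (hCk : Ck = 4^(k+1) * 6 * (3 * Real.exp 1)^k / (1 + (k:ℝ))) :
    (∀ n : ℕ, k + 1 < n → ∀ x ∈ Set.Icc (-1:ℝ) 1,
      |f x - fn n x| ≤ Ck * M * (n:ℝ) ^ ((1:ℤ) - (k:ℤ))) ∧
    (2 ≤ k → ∀ ε : ℝ, 0 < ε →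
      ∀ x ∈ Set.Icc (-1:ℝ) 1,
        |f x - fn (max (k+2) ⌈(2 * Ck * M / ε) ^ ((1:ℝ)/((k:ℝ)-1))⌉₊) x| ≤ ε/2) := by
  have hcont : Continuous (iteratedDeriv (k+1) f) :=
    hf.continuous_iteratedDeriv (k+1) (by norm_cast)
  have hMb : ∀ x ∈ Set.Icc (-1:ℝ) 1, |iteratedDeriv (k+1) f x| ≤ M := by
    intro x hx
    rw [hM]
    exact le_csSup (isCompact_Icc.bddAbove_image hcont.abs.continuousOn) ⟨x, hx, rfl⟩
  have hM0 : 0 ≤ M := (abs_nonneg _).trans (hMb 0 (by simp))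
  have hCk0 : 0 ≤ Ck := by rw [hCk]; positivity
  have haj : ∀ j, a j = (2 / Real.pi) * cc f j := by
    intro j
    rw [ha j]
    congr 1
    have h1 := Polynomial.Chebyshev.integral_measureT_eq_integral_cos
      (f := fun x => Real.cos (j * Real.arccos x) * f x)
    rw [Polynomial.Chebyshev.integral_measureT] at h1
    calc _ = _ := by
          apply intervalIntegral.integral_congr
          intro x _
          simp only [Real.sqrt_inv]
          rw [div_eq_mul_inv]
      _ = _ := h1
      _ = cc f j := by
          unfold cc
          apply intervalIntegral.integral_congr
          intro θ hθ
          rw [Set.uIcc_of_le Real.pi_pos.le] at hθ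
          simp only [Real.arccos_cos hθ.1 hθ.2]
          ring
  have part1 : ∀ n : ℕ, k + 1 < n → ∀ x ∈ Set.Icc (-1:ℝ) 1,
      |f x - fn n x| ≤ Ck * M * (n:ℝ) ^ ((1:ℤ) - (k:ℤ)) := by
    intro n hn x hx
    have h := main_bound f k n hk (by omega) hf M hMb (Real.arccos x)
    rw [Real.cos_arccos hx.1 hx.2] at h
    have h2 : f x - fn n x = f x + (1/2) * ((2/Real.pi) * cc f 0) -
        ∑ j ∈ Finset.range (n+1), (2/Real.pi) * cc f j * Real.cos (j * Real.arccos x) := by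
      rw [hfn, Finset.range_eq_Ico, Finset.sum_eq_sum_Ico_succ_bot (by omega)]
      simp only [haj, zero_add]
      rw [show Finset.Ico 1 (n+1) = Finset.Icc 1 n by ext; simp]
      simp
      ring
    rw [h2]
    refine h.trans ?_
    have := mul_le_mul_of_nonneg_left (const_bound k n hk (by omega)) hM0
    rw [← hCk] at this
    nlinarith
  refine ⟨part1, ?_⟩
  intro hk2 ε hε x hx
  set N := max (k+2) ⌈(2 * Ck * M / ε) ^ ((1:ℝ)/((k:ℝ)-1))⌉₊ with hN
  have hNk : k + 2 ≤ N := le_max_left _ _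
  refine (part1 N (by omega) x hx).trans ?_
  have hN0 : (0:ℝ) < N := by exact_mod_cast (by omega : 0 < N)
  have hB : 0 ≤ 2 * Ck * M / ε := by positivity
  have h1 : (2 * Ck * M / ε) ^ ((1:ℝ)/((k:ℝ)-1)) ≤ N :=
    (Nat.le_ceil _).trans (Nat.cast_le.2 (le_max_right _ _))
  have hk' : (0:ℝ) < (k:ℝ) - 1 := by
    have : (2:ℝ) ≤ k := by exact_mod_cast hk2
    linarith
  have h2 : 2 * Ck * M / ε ≤ (N:ℝ) ^ ((k:ℝ) - 1) := by
    have := Real.rpow_le_rpow (by positivity) h1 hk'.le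
    rwa [← Real.rpow_mul hB, one_div_mul_cancel hk'.ne', Real.rpow_one] at this
  have h3 : (N:ℝ) ^ ((1:ℤ) - (k:ℤ)) = ((N:ℝ) ^ ((k:ℝ) - 1))⁻¹ := by
    rw [← Real.rpow_neg hN0.le, ← Real.rpow_intCast]
    congr 1
    push_cast
    ring
  rw [h3, ← div_eq_mul_inv, div_le_iff₀ (by positivity)]
  rw [div_le_iff₀ hε] at h2
  linarith
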